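/- Let (u,v) be a positive radial C² solution of the system on [0,R) with central values (a,b), a,b > 0, where R < ∞ and u(r) → ∞, v(r) → ∞ as r ↑ R. Then for every r ∈ (0,R): Φ(u(r)) ≤ g(b/f(a) + L_q) ∫_r^R t^{1−n} ∫₀^t s^{n−1} p(s) ds dt and Ψ(v(r)) ≤ f(a/g(b) + L_p) ∫_r^R t^{1−n} ∫₀^t s^{n−1} q(s) ds dt. -/

import Mathlib

open MeasureTheory Set Filter Topology

noncomputable section

/-- The iterated radial kernel
`∫₀^r t^{1-n} ∫₀^t s^{n-1} w(s) h(φ(s)) ds dt`. -/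
def radK (n : ℕ) (w h φ : ℝ → ℝ) (r : ℝ) : ℝ :=
  ∫ t in (0:ℝ)..r, t ^ (1 - (n : ℤ)) *
    ∫ s in (0:ℝ)..t, s ^ ((n : ℤ) - 1) * w s * h (φ s)

/-- Hypothesis (F1). -/
def hypF1 (f g : ℝ → ℝ) : Prop :=
  ContinuousOn f (Ici 0) ∧ ContinuousOn g (Ici 0) ∧
  DifferentiableOn ℝ f (Ioi 0) ∧ DifferentiableOn ℝ g (Ioi 0) ∧
  MonotoneOn f (Ici 0) ∧ MonotoneOn g (Ici 0) ∧
  f 0 = 0 ∧ g 0 = 0 ∧ (∀ s : ℝ, 0 < s → 0 < f s) ∧ (∀ s : ℝ, 0 < s → 0 < g s)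

/-- Hypothesis (F2): multiplicative subadditivity. -/
def hypF2 (f g : ℝ → ℝ) : Prop :=
  (∀ s : ℝ, 0 ≤ s → ∀ r : ℝ, 0 ≤ r → f (s * r) ≤ f s * f r) ∧
  (∀ l : ℝ, 0 ≤ l → ∀ t : ℝ, 0 ≤ t → g (l * t) ≤ g l * g t)

/-- Hypothesis (F3): finite Keller–Osserman integrals. -/
def hypF3 (f g : ℝ → ℝ) : Prop :=
  IntegrableOn (fun t : ℝ => 1 / Real.sqrt (∫ z in (0:ℝ)..t, g (f z))) (Ioi 1) ∧
  IntegrableOn (fun t : ℝ => 1 / Real.sqrt (∫ z in (0:ℝ)..t, f (g z))) (Ioi 1)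

/-- Hypothesis (PQ). -/
def hypPQ (p q : ℝ → ℝ) : Prop :=
  ContinuousOn p (Ici 0) ∧ ContinuousOn q (Ici 0) ∧
  (∀ s : ℝ, 0 ≤ s → 0 ≤ p s) ∧ (∀ s : ℝ, 0 ≤ s → 0 ≤ q s) ∧
  (¬ ∀ s : ℝ, 0 ≤ s → p s = 0 ∧ q s = 0) ∧
  IntegrableOn (fun s : ℝ => s * p s) (Ioi 0) ∧
  IntegrableOn (fun s : ℝ => s * q s) (Ioi 0) ∧
  ¬ ∃ R : ℝ, ∀ s : ℝ, R ≤ s → min (p s) (q s) = 0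

/-- `L_w = (1/(n-2)) ∫₀^∞ s w(s) ds`. -/
def Lcoef (n : ℕ) (w : ℝ → ℝ) : ℝ := (1 / ((n : ℝ) - 2)) * ∫ s in Ioi (0:ℝ), s * w s

/-- Keller–Osserman transform `Φ(t) = ∫_t^∞ ds / g(f(s))`. -/
def PhiKO (f g : ℝ → ℝ) (t : ℝ) : ℝ := ∫ s in Ioi t, 1 / g (f s)

/-- Keller–Osserman transform `Ψ(t) = ∫_t^∞ ds / f(g(s))`. -/
def PsiKO (f g : ℝ → ℝ) (t : ℝ) : ℝ := ∫ s in Ioi t, 1 / f (g s)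

/-- Positive radial `C²` solution (integral form) on `[0, ρ)` with central values `(a,b)`. -/
def IsRadSol (n : ℕ) (p q f g : ℝ → ℝ) (a b ρ : ℝ) (u v : ℝ → ℝ) : Prop :=
  ContDiffOn ℝ 2 u (Ico 0 ρ) ∧ ContDiffOn ℝ 2 v (Ico 0 ρ) ∧
  (∀ r ∈ Ico (0:ℝ) ρ, 0 < u r ∧ 0 < v r) ∧
  (∀ r ∈ Ico (0:ℝ) ρ, u r = a + radK n p g v r) ∧
  (∀ r ∈ Ico (0:ℝ) ρ, v r = b + radK n q f u r)

/-- Positive radial `C²` solution (integral form) on the closed interval `[0, R]`. -/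
def IsRadSolIcc (n : ℕ) (p q f g : ℝ → ℝ) (a b R : ℝ) (u v : ℝ → ℝ) : Prop :=
  ContDiffOn ℝ 2 u (Icc 0 R) ∧ ContDiffOn ℝ 2 v (Icc 0 R) ∧
  (∀ r ∈ Icc (0:ℝ) R, 0 < u r ∧ 0 < v r) ∧
  (∀ r ∈ Icc (0:ℝ) R, u r = a + radK n p g v r) ∧
  (∀ r ∈ Icc (0:ℝ) R, v r = b + radK n q f u r)

/-- Entire positive radial `C²` solution (integral form) with central values `(a,b)`. -/
def IsEntireRadSol (n : ℕ) (p q f g : ℝ → ℝ) (a b : ℝ) (u v : ℝ → ℝ) : Prop :=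
  ContDiffOn ℝ 2 u (Ici 0) ∧ ContDiffOn ℝ 2 v (Ici 0) ∧
  (∀ r ∈ Ici (0:ℝ), 0 < u r ∧ 0 < v r) ∧
  (∀ r ∈ Ici (0:ℝ), u r = a + radK n p g v r) ∧
  (∀ r ∈ Ici (0:ℝ), v r = b + radK n q f u r)

/-- Positive `C²` solution of the radial ODE system on `[0, ρ)` with central values `(a,b)`. -/
def IsRadODESol (n : ℕ) (p q f g : ℝ → ℝ) (a b ρ : ℝ) (u v : ℝ → ℝ) : Prop :=
  ContDiffOn ℝ 2 u (Ico 0 ρ) ∧ ContDiffOn ℝ 2 v (Ico 0 ρ) ∧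
  (∀ r ∈ Ico (0:ℝ) ρ, 0 < u r ∧ 0 < v r) ∧
  u 0 = a ∧ v 0 = b ∧ deriv u 0 = 0 ∧ deriv v 0 = 0 ∧
  (∀ r ∈ Ioo (0:ℝ) ρ,
    deriv (deriv u) r + ((n : ℝ) - 1) / r * deriv u r = p r * g (v r) ∧
    deriv (deriv v) r + ((n : ℝ) - 1) / r * deriv v r = q r * f (u r))

/-- The set `S` of central values admitting an entire positive radial solution. -/
def centralSet (n : ℕ) (p q f g : ℝ → ℝ) : Set (ℝ × ℝ) :=
  {ab : ℝ × ℝ | 0 ≤ ab.1 ∧ 0 ≤ ab.2 ∧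
    ∃ u v : ℝ → ℝ, IsEntireRadSol n p q f g ab.1 ab.2 u v}

/-- The set of radii `ρ > 0` on which a positive solution of the radial ODE system exists. -/
def odeSolSet (n : ℕ) (p q f g : ℝ → ℝ) (a b : ℝ) : Set ℝ :=
  {ρ : ℝ | 0 < ρ ∧ ∃ u v : ℝ → ℝ, IsRadODESol n p q f g a b ρ u v}

end


noncomputable def FFk (m : ℕ) (h : ℝ → ℝ) (t : ℝ) : ℝ :=
  (t ^ (m+1))⁻¹ * ∫ s in (0:ℝ)..t, s ^ (m+1) * h s

lemma ii_of_cont {R : ℝ} {h : ℝ → ℝ} (hc : ContinuousOn h (Ico 0 R)) {x y : ℝ}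
    (hx : x ∈ Ico 0 R) (hy : y ∈ Ico 0 R) : IntervalIntegrable h volume x y := by
  apply ContinuousOn.intervalIntegrable
  exact hc.mono ((ordConnected_Ico).uIcc_subset hx hy)

lemma hasDeriv_int {R : ℝ} {h : ℝ → ℝ} (hc : ContinuousOn h (Ico 0 R)) {x t : ℝ}
    (hx : x ∈ Ico 0 R) (ht : t ∈ Ioo 0 R) :
    HasDerivAt (fun t => ∫ s in x..t, h s) (h t) t := by
  have hc' : ContinuousOn h (Ioo 0 R) := hc.mono Ioo_subset_Ico_self
  apply intervalIntegral.integral_hasDerivAt_right (ii_of_cont hc hx ⟨ht.1.le, ht.2⟩)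
  · exact hc'.stronglyMeasurableAtFilter isOpen_Ioo t ht
  · exact hc'.continuousAt (isOpen_Ioo.mem_nhds ht)

lemma cont_int {R : ℝ} {h : ℝ → ℝ} (hc : ContinuousOn h (Ico 0 R)) {x : ℝ}
    (hx : x ∈ Ico 0 R) :
    ContinuousOn (fun t => ∫ s in x..t, h s) (Ico 0 R) := by
  intro t ht
  obtain ⟨T, hT1, hT2⟩ := exists_between (max_lt ht.2 hx.2)
  have hT0 : 0 ≤ T := le_trans (le_trans ht.1 (le_max_left _ _)) hT1.le
  have h1 : ContinuousOn (fun t => ∫ s in x..t, h s) (uIcc 0 T) := by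
    apply intervalIntegral.continuousOn_primitive_interval'
    · exact ii_of_cont hc ⟨le_rfl, hT0.trans_lt hT2⟩ ⟨hT0, hT2⟩
    · rw [uIcc_of_le hT0]; exact ⟨hx.1, (le_max_right _ _).trans hT1.le⟩
  rw [uIcc_of_le hT0] at h1
  have htT : t < T := (le_max_left _ _).trans_lt hT1
  have := h1 t ⟨ht.1, htT.le⟩
  apply this.mono_of_mem_nhdsWithin
  rw [mem_nhdsWithin]
  exact ⟨Iio T, isOpen_Iio, htT, fun y hy => ⟨hy.2.1, le_of_lt hy.1⟩⟩

lemma cont_pow_mul {R : ℝ} (k : ℕ) {h : ℝ → ℝ} (hc : ContinuousOn h (Ico 0 R)) :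
    ContinuousOn (fun s => s ^ k * h s) (Ico 0 R) :=
  (continuous_pow k).continuousOn.mul hc

lemma FFk_zero (m : ℕ) (h : ℝ → ℝ) : FFk m h 0 = 0 := by simp [FFk]

lemma FFk_nonneg {R : ℝ} (m : ℕ) {h : ℝ → ℝ} (h0 : ∀ s ∈ Ico 0 R, 0 ≤ h s) {t : ℝ}
    (ht : t ∈ Ico 0 R) : 0 ≤ FFk m h t := by
  have := ht.1
  apply mul_nonneg (by positivity)
  apply intervalIntegral.integral_nonneg ht.1
  intro s hs
  exact mul_nonneg (pow_nonneg hs.1 _) (h0 s ⟨hs.1, hs.2.trans_lt ht.2⟩)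

lemma FFk_le {R : ℝ} (m : ℕ) {h k : ℝ → ℝ} (hc : ContinuousOn h (Ico 0 R))
    (kc : ContinuousOn k (Ico 0 R)) {t c : ℝ} (ht : t ∈ Ico 0 R)
    (hk : ∀ s ∈ Icc 0 t, h s ≤ c * k s) : FFk m h t ≤ c * FFk m k t := by
  have h0t := ht.1
  have hR : (0:ℝ) ∈ Ico 0 R := ⟨le_rfl, ht.1.trans_lt ht.2⟩
  have : c * FFk m k t = (t ^ (m+1))⁻¹ * ∫ s in (0:ℝ)..t, s ^ (m+1) * (c * k s) := by
    have e : ∀ s, s ^ (m+1) * (c * k s) = c * (s ^ (m+1) * k s) := fun s => by ring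
    simp only [e, intervalIntegral.integral_const_mul, FFk]; ring
  rw [this]
  apply mul_le_mul_of_nonneg_left _ (by positivity)
  apply intervalIntegral.integral_mono_on ht.1
  · exact ii_of_cont (cont_pow_mul _ hc) hR ht
  · exact ii_of_cont (cont_pow_mul _ (continuousOn_const.mul kc)) hR ht
  · intro s hs
    exact mul_le_mul_of_nonneg_left (hk s hs) (pow_nonneg hs.1 _)

lemma FFk_le_int {R : ℝ} (m : ℕ) {h : ℝ → ℝ} (hc : ContinuousOn h (Ico 0 R))
    (h0 : ∀ s ∈ Ico 0 R, 0 ≤ h s) {t : ℝ} (ht : t ∈ Ico 0 R) :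
    FFk m h t ≤ ∫ s in (0:ℝ)..t, h s := by
  have hR : (0:ℝ) ∈ Ico 0 R := ⟨le_rfl, ht.1.trans_lt ht.2⟩
  rcases ht.1.eq_or_lt with h | h0t
  · subst h; simp [FFk]
  unfold FFk
  rw [inv_mul_le_iff₀ (by positivity), ← intervalIntegral.integral_const_mul]
  apply intervalIntegral.integral_mono_on ht.1
  · exact ii_of_cont (cont_pow_mul _ hc) hR ht
  · exact ii_of_cont (continuousOn_const.mul hc) hR ht
  · intro s hs
    exact mul_le_mul_of_nonneg_right (pow_le_pow_left₀ hs.1 hs.2 _)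
      (h0 s ⟨hs.1, hs.2.trans_lt ht.2⟩)

lemma FFk_cont {R : ℝ} (m : ℕ) {h : ℝ → ℝ} (hc : ContinuousOn h (Ico 0 R))
    (h0 : ∀ s ∈ Ico 0 R, 0 ≤ h s) : ContinuousOn (FFk m h) (Ico 0 R) := by
  intro t ht
  have hR : (0:ℝ) ∈ Ico 0 R := ⟨le_rfl, ht.1.trans_lt ht.2⟩
  rcases ht.1.eq_or_lt with h' | h0t
  · subst h'
    unfold ContinuousWithinAt
    rw [FFk_zero]
    have hi := cont_int hc hR 0 hR
    unfold ContinuousWithinAt at hi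
    simp only [intervalIntegral.integral_same] at hi
    refine tendsto_of_tendsto_of_tendsto_of_le_of_le' tendsto_const_nhds hi ?_ ?_
    · filter_upwards [self_mem_nhdsWithin] with s hs using FFk_nonneg m h0 hs
    · filter_upwards [self_mem_nhdsWithin] with s hs using FFk_le_int m hc h0 hs
  · apply ContinuousWithinAt.mul
    · apply ContinuousWithinAt.inv₀
      · exact (continuous_pow _).continuousWithinAt
      · positivity
    · exact cont_int (cont_pow_mul _ hc) hR t ht

lemma FFk_int_le {R : ℝ} (m : ℕ) (hm : 1 ≤ m) {h : ℝ → ℝ} (hc : ContinuousOn h (Ico 0 R))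
    (h0 : ∀ s ∈ Ico 0 R, 0 ≤ h s) {t : ℝ} (ht : t ∈ Ico 0 R) :
    m * (∫ s in (0:ℝ)..t, FFk m h s) ≤ ∫ s in (0:ℝ)..t, s * h s := by
  have hR : (0:ℝ) ∈ Ico 0 R := ⟨le_rfl, ht.1.trans_lt ht.2⟩
  have hF := FFk_cont m hc h0
  have hsc : ContinuousOn (fun s => s * h s) (Ico 0 R) := continuousOn_id.mul hc
  let D : ℝ → ℝ := fun t => (∫ s in (0:ℝ)..t, s * h s) - m * (∫ s in (0:ℝ)..t, FFk m h s)
    - t * FFk m h t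
  have hDc : ContinuousOn D (Ico 0 R) :=
    ((cont_int hsc hR).sub (continuousOn_const.mul (cont_int hF hR))).sub (continuousOn_id.mul hF)
  have hD : ∀ x ∈ Ioo 0 R, HasDerivAt D 0 x := by
    intro x hx
    have hx0 : x ≠ 0 := hx.1.ne'
    have h1 := hasDeriv_int hsc hR hx
    have h2 := hasDeriv_int hF hR hx
    have h3 := hasDeriv_int (cont_pow_mul (m+1) hc) hR hx
    have h4 : HasDerivAt (fun t : ℝ => (t ^ (m+1))⁻¹) (-((m+1 : ℕ) * x ^ m) / (x^(m+1))^2) x := by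
      simpa using (hasDerivAt_pow (m+1) x).fun_inv (pow_ne_zero _ hx0)
    have h5 := (hasDerivAt_id x).mul (h4.mul h3)
    have h6 := (h1.sub (h2.const_mul (m:ℝ))).sub h5
    refine h6.congr_deriv ?_
    simp only [FFk, id, Pi.mul_apply]
    push_cast
    field_simp
    ring
  have mono : MonotoneOn D (Ico 0 R) := by
    apply monotoneOn_of_deriv_nonneg (convex_Ico _ _) hDc
    · rw [interior_Ico]
      exact fun x hx => (hD x hx).differentiableAt.differentiableWithinAt
    · rw [interior_Ico]
      exact fun x hx => (hD x hx).deriv.ge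
  have := mono hR ht ht.1
  have e0 : D 0 = 0 := by simp [D]
  rw [e0] at this
  have := mul_nonneg ht.1 (FFk_nonneg m h0 ht)
  simp only [D] at *
  linarith

lemma mono_int {R : ℝ} {F : ℝ → ℝ} (hc : ContinuousOn F (Ico 0 R))
    (h0 : ∀ s ∈ Ico 0 R, 0 ≤ F s) {x y : ℝ} (hx : 0 ≤ x) (hxy : x ≤ y) (hy : y < R) :
    ∫ s in (0:ℝ)..x, F s ≤ ∫ s in (0:ℝ)..y, F s := by
  have hR : (0:ℝ) ∈ Ico 0 R := ⟨le_rfl, hx.trans_lt (hxy.trans_lt hy)⟩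
  have hx' : x ∈ Ico 0 R := ⟨hx, hxy.trans_lt hy⟩
  have hy' : y ∈ Ico 0 R := ⟨hx.trans hxy, hy⟩
  have := intervalIntegral.integral_add_adjacent_intervals (ii_of_cont hc hR hx')
    (ii_of_cont hc hx' hy')
  have := intervalIntegral.integral_nonneg (f := F) (μ := volume) hxy
    (fun s hs => h0 s ⟨hx.trans hs.1, hs.2.trans_lt hy⟩)
  linarith

lemma KO_half (m : ℕ) (hm : 1 ≤ m) (f g p q : ℝ → ℝ)
    (fc : ContinuousOn f (Ici 0)) (gc : ContinuousOn g (Ici 0))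
    (fm : MonotoneOn f (Ici 0)) (gm : MonotoneOn g (Ici 0))
    (f0 : f 0 = 0) (g0 : g 0 = 0)
    (fp : ∀ s : ℝ, 0 < s → 0 < f s) (gp : ∀ s : ℝ, 0 < s → 0 < g s)
    (gs : ∀ l : ℝ, 0 ≤ l → ∀ t : ℝ, 0 ≤ t → g (l * t) ≤ g l * g t)
    (pc : ContinuousOn p (Ici 0)) (qc : ContinuousOn q (Ici 0))
    (p0 : ∀ s : ℝ, 0 ≤ s → 0 ≤ p s) (q0 : ∀ s : ℝ, 0 ≤ s → 0 ≤ q s)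
    (qi : IntegrableOn (fun s : ℝ => s * q s) (Ioi 0))
    (hint : IntegrableOn (fun s : ℝ => 1 / g (f s)) (Ioi 1))
    (a b R : ℝ) (ha : 0 < a) (hb : 0 < b) (u v : ℝ → ℝ)
    (uc : ContinuousOn u (Ico 0 R)) (vc : ContinuousOn v (Ico 0 R))
    (hpos : ∀ r ∈ Ico (0:ℝ) R, 0 < u r ∧ 0 < v r)
    (hu : ∀ r ∈ Ico (0:ℝ) R, u r = a + ∫ t in (0:ℝ)..r, FFk m (fun s => p s * g (v s)) t)
    (hv : ∀ r ∈ Ico (0:ℝ) R, v r = b + ∫ t in (0:ℝ)..r, FFk m (fun s => q s * f (u s)) t)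
    (hblow : Tendsto u (𝓝[<] R) atTop) (r : ℝ) (hr : r ∈ Ioo 0 R) :
    PhiKO f g (u r) ≤ g (b / f a + (1 / (m:ℝ)) * ∫ s in Ioi (0:ℝ), s * q s) *
        ∫ t in r..R, FFk m p t := by
  have hR : (0:ℝ) ∈ Ico 0 R := ⟨le_rfl, hr.1.trans hr.2⟩
  have hr' : r ∈ Ico 0 R := ⟨hr.1.le, hr.2⟩
  set L := (1 / (m:ℝ)) * ∫ s in Ioi (0:ℝ), s * q s with hL
  set M := b / f a + L with hM
  have hm0 : (0:ℝ) < m := by exact_mod_cast hm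
  have sub : Ico 0 R ⊆ Ici 0 := fun x hx => hx.1
  have f00 : ∀ s, 0 ≤ s → 0 ≤ f s := fun s hs => by
    rcases hs.eq_or_lt with h | h
    · rw [← h, f0]
    · exact (fp s h).le
  have g00 : ∀ s, 0 ≤ s → 0 ≤ g s := fun s hs => by
    rcases hs.eq_or_lt with h | h
    · rw [← h, g0]
    · exact (gp s h).le
  have pgc : ContinuousOn (fun s => p s * g (v s)) (Ico 0 R) :=
    (pc.mono sub).mul (gc.comp vc (fun s hs => (hpos s hs).2.le))
  have qfc : ContinuousOn (fun s => q s * f (u s)) (Ico 0 R) :=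
    (qc.mono sub).mul (fc.comp uc (fun s hs => (hpos s hs).1.le))
  have pg0 : ∀ s ∈ Ico 0 R, 0 ≤ p s * g (v s) := fun s hs =>
    mul_nonneg (p0 s hs.1) (g00 _ (hpos s hs).2.le)
  have qf0 : ∀ s ∈ Ico 0 R, 0 ≤ q s * f (u s) := fun s hs =>
    mul_nonneg (q0 s hs.1) (f00 _ (hpos s hs).1.le)
  have Upc := FFk_cont m pgc pg0
  have Vpc := FFk_cont m qfc qf0
  have umono : ∀ x y, 0 ≤ x → x ≤ y → y < R → u x ≤ u y := fun x y h1 h2 h3 => by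
    rw [hu x ⟨h1, h2.trans_lt h3⟩, hu y ⟨h1.trans h2, h3⟩]
    linarith [mono_int Upc (fun s hs => FFk_nonneg m pg0 hs) h1 h2 h3]
  have vmono : ∀ x y, 0 ≤ x → x ≤ y → y < R → v x ≤ v y := fun x y h1 h2 h3 => by
    rw [hv x ⟨h1, h2.trans_lt h3⟩, hv y ⟨h1.trans h2, h3⟩]
    linarith [mono_int Vpc (fun s hs => FFk_nonneg m qf0 hs) h1 h2 h3]
  have hu0 : u 0 = a := by rw [hu 0 hR]; simp
  have hL0 : 0 ≤ L := by
    apply mul_nonneg (by positivity)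
    apply setIntegral_nonneg measurableSet_Ioi
    intro s hs
    exact mul_nonneg (le_of_lt hs) (q0 s (le_of_lt hs))
  have hfa := fp a ha
  have hM0 : 0 < M := by positivity
  have hgM := gp M hM0
  -- L bound
  have Lb : ∀ t ∈ Ico 0 R, ∫ s in (0:ℝ)..t, FFk m q s ≤ L := by
    intro t ht
    have h1 := FFk_int_le m hm (qc.mono sub) (fun s hs => q0 s hs.1) ht
    have h2 : ∫ s in (0:ℝ)..t, s * q s ≤ ∫ s in Ioi (0:ℝ), s * q s := by
      rw [intervalIntegral.integral_of_le ht.1]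
      apply setIntegral_mono_set qi
      · filter_upwards [ae_restrict_mem measurableSet_Ioi] with s hs
        exact mul_nonneg (le_of_lt hs) (q0 s (le_of_lt hs))
      · exact (Ioc_subset_Ioi_self).eventuallyLE
    rw [hL, one_div, ← div_eq_inv_mul, le_div_iff₀ hm0]
    linarith
  have vb : ∀ t ∈ Ico 0 R, v t ≤ M * f (u t) := by
    intro t ht
    have hqc := FFk_cont m (qc.mono sub) (fun s (hs : s ∈ Ico 0 R) => q0 s hs.1)
    have h1 : ∫ x in (0:ℝ)..t, FFk m (fun s => q s * f (u s)) x ≤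
        ∫ x in (0:ℝ)..t, f (u t) * FFk m q x := by
      apply intervalIntegral.integral_mono_on ht.1 (ii_of_cont Vpc hR ht)
        (ii_of_cont (continuousOn_const.mul hqc) hR ht)
      intro x hx
      have hx' : x ∈ Ico 0 R := ⟨hx.1, hx.2.trans_lt ht.2⟩
      apply FFk_le m qfc (qc.mono sub) hx'
      intro s hs
      have hs' : s ∈ Ico 0 R := ⟨hs.1, hs.2.trans_lt hx'.2⟩
      rw [mul_comm]
      apply mul_le_mul_of_nonneg_right _ (q0 s hs.1)
      exact fm (hpos s hs').1.le (hpos t ht).1.le (umono s t hs.1 (hs.2.trans hx.2) ht.2)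
    rw [intervalIntegral.integral_const_mul] at h1
    have h2 := mul_le_mul_of_nonneg_left (Lb t ht) (f00 _ (hpos t ht).1.le)
    have h3 : f a ≤ f (u t) := by
      apply fm ha.le (hpos t ht).1.le
      rw [← hu0]; exact umono 0 t le_rfl ht.1 ht.2
    have h4 : b ≤ b / f a * f (u t) := by
      rw [div_mul_eq_mul_div, le_div_iff₀ hfa]
      exact mul_le_mul_of_nonneg_left h3 hb.le
    rw [hv t ht, hM]
    linarith
  have Ub : ∀ t ∈ Ico 0 R, FFk m (fun s => p s * g (v s)) t ≤
      g M * g (f (u t)) * FFk m p t := by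
    intro t ht
    apply FFk_le m pgc (pc.mono sub) ht
    intro s hs
    have hs' : s ∈ Ico 0 R := ⟨hs.1, hs.2.trans_lt ht.2⟩
    rw [mul_comm]
    apply mul_le_mul_of_nonneg_right _ (p0 s hs.1)
    have hfu := f00 _ (hpos t ht).1.le
    calc g (v s) ≤ g (M * f (u t)) := gm (hpos s hs').2.le (mul_nonneg hM0.le hfu)
            ((vmono s t hs.1 hs.2 ht.2).trans (vb t ht))
      _ ≤ _ := gs M hM0.le _ hfu
  -- the function 1/g(f)
  let k : ℝ → ℝ := fun s => 1 / g (f s)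
  have kc : ContinuousOn k (Ioi 0) := by
    apply continuousOn_const.div
    · exact gc.comp (fc.mono Ioi_subset_Ici_self) (fun s hs => f00 s (le_of_lt hs))
    · intro s hs; exact (gp _ (fp s hs)).ne'
  have ki : ∀ x y, 0 < x → 0 < y → IntervalIntegrable k volume x y := fun x y hx hy =>
    (kc.mono (ordConnected_Ioi.uIcc_subset hx hy)).intervalIntegrable
  have kI : IntegrableOn k (Ioi (u r)) := by
    have h1 := (ki (u r) (max (u r) 1) (hpos r hr').1 (by positivity))
    rw [intervalIntegrable_iff_integrableOn_Ioc_of_le (le_max_left _ _)] at h1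
    rw [← Ioc_union_Ioi_eq_Ioi (le_max_left (u r) 1)]
    exact h1.union (hint.mono_set (Ioi_subset_Ioi (le_max_right _ _)))
  have lim : Tendsto (fun t => ∫ s in (u r)..(u t), k s) (𝓝[<] R) (𝓝 (PhiKO f g (u r))) :=
    intervalIntegral_tendsto_integral_Ioi (u r) kI hblow
  -- W
  have Wc : ContinuousOn (FFk m p) (Ico 0 (R+1)) :=
    FFk_cont m (pc.mono fun x hx => hx.1) (fun s hs => p0 s hs.1)
  have W0 : ∀ t ∈ Ico 0 (R+1), 0 ≤ FFk m p t := fun t ht =>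
    FFk_nonneg m (fun s (hs : s ∈ Ico 0 (R+1)) => p0 s hs.1) ht
  have Wc' : ContinuousOn (FFk m p) (Ico 0 R) :=
    Wc.mono (Ico_subset_Ico_right (by linarith))
  let D : ℝ → ℝ := fun t => g M * (∫ s in r..t, FFk m p s) - ∫ s in (u r)..(u t), k s
  have ud : ∀ x ∈ Ioo 0 R, HasDerivAt u (FFk m (fun s => p s * g (v s)) x) x := by
    intro x hx
    have h1 := (hasDeriv_int Upc hR hx).const_add a
    apply h1.congr_of_eventuallyEq
    filter_upwards [isOpen_Ioo.mem_nhds hx] with y hy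
    exact hu y ⟨hy.1.le, hy.2⟩
  have hD : ∀ x ∈ Ioo 0 R, HasDerivAt D (g M * FFk m p x -
      k (u x) * FFk m (fun s => p s * g (v s)) x) x := by
    intro x hx
    have hux := (hpos x ⟨hx.1.le, hx.2⟩).1
    have h1 := (hasDeriv_int Wc' hr' hx).const_mul (g M)
    have h2 : HasDerivAt (fun y => ∫ s in (u r)..y, k s) (k (u x)) (u x) := by
      apply intervalIntegral.integral_hasDerivAt_right (ki _ _ (hpos r hr').1 hux)
      · exact kc.stronglyMeasurableAtFilter isOpen_Ioi _ hux
      · exact kc.continuousAt (isOpen_Ioi.mem_nhds hux)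
    exact h1.sub (h2.comp x (ud x hx))
  have mono : MonotoneOn D (Ioo 0 R) := by
    apply monotoneOn_of_deriv_nonneg (convex_Ioo _ _)
    · exact fun x hx => (hD x hx).continuousAt.continuousWithinAt
    · rw [interior_Ioo]
      exact fun x hx => (hD x hx).differentiableAt.differentiableWithinAt
    · rw [interior_Ioo]
      intro x hx
      rw [(hD x hx).deriv]
      have hx' : x ∈ Ico 0 R := ⟨hx.1.le, hx.2⟩
      have hg := gp _ (fp _ (hpos x hx').1)
      have := Ub x hx'
      simp only [k]
      rw [sub_nonneg, one_div, inv_mul_le_iff₀ hg]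
      linarith
  apply le_of_tendsto lim
  filter_upwards [Ioo_mem_nhdsLT hr.2] with t ht
  have h1 := mono hr ⟨hr.1.trans ht.1, ht.2⟩ ht.1.le
  have e0 : D r = 0 := by simp [D]
  rw [e0] at h1
  simp only [D] at h1
  have hRm : R ∈ Ico 0 (R+1) := ⟨hR.2.le, by linarith⟩
  have htm : t ∈ Ico 0 (R+1) := ⟨(hr.1.trans ht.1).le, by linarith [ht.2]⟩
  have hrm : r ∈ Ico 0 (R+1) := ⟨hr.1.le, by linarith [hr.2]⟩
  have h2 := intervalIntegral.integral_add_adjacent_intervals (ii_of_cont Wc hrm htm)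
    (ii_of_cont Wc htm hRm)
  have h3 := intervalIntegral.integral_nonneg (f := FFk m p) (μ := volume) ht.2.le
    (fun s hs => W0 s ⟨htm.1.trans hs.1, hs.2.trans_lt hRm.2⟩)
  have h4 : g M * (∫ s in r..t, FFk m p s) ≤ g M * ∫ s in r..R, FFk m p s :=
    mul_le_mul_of_nonneg_left (by linarith) hgM.le
  linarith

lemma FFk_zpow (m : ℕ) (h : ℝ → ℝ) (t : ℝ) :
    t ^ (1 - ((m + 2 : ℕ) : ℤ)) * ∫ s in (0:ℝ)..t, s ^ (((m + 2 : ℕ) : ℤ) - 1) * h s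
      = FFk m h t := by
  have e1 : (1 - ((m + 2 : ℕ) : ℤ)) = -((m+1 : ℕ) : ℤ) := by push_cast; ring
  have e2 : (((m + 2 : ℕ) : ℤ) - 1) = ((m+1 : ℕ) : ℤ) := by push_cast; ring
  simp only [e1, e2, zpow_neg, zpow_natCast, FFk]

lemma radK_eq (m : ℕ) (w h φ : ℝ → ℝ) (r : ℝ) :
    radK (m+2) w h φ r = ∫ t in (0:ℝ)..r, FFk m (fun s => w s * h (φ s)) t := by
  unfold radK
  simp only [mul_assoc, FFk_zpow m (fun s => w s * h (φ s))]

/-- Keller–Osserman upper bounds near a finite blow-up radius. -/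
theorem KO_bound_near_blow_up
    (n : ℕ) (hn : 3 ≤ n) (f g p q : ℝ → ℝ)
    (hF1 : hypF1 f g) (hF2 : hypF2 f g) (hPQ : hypPQ p q)
    (hint1 : IntegrableOn (fun s : ℝ => 1 / g (f s)) (Ioi 1))
    (hint2 : IntegrableOn (fun s : ℝ => 1 / f (g s)) (Ioi 1))
    (a b R : ℝ) (ha : 0 < a) (hb : 0 < b) (hRpos : 0 < R)
    (u v : ℝ → ℝ) (hsol : IsRadSol n p q f g a b R u v)
    (hblowu : Tendsto u (𝓝[<] R) atTop) (hblowv : Tendsto v (𝓝[<] R) atTop) :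
    ∀ r ∈ Ioo (0:ℝ) R,
      PhiKO f g (u r) ≤ g (b / f a + Lcoef n q) *
        ∫ t in r..R, t ^ (1 - (n : ℤ)) *
          ∫ s in (0:ℝ)..t, s ^ ((n : ℤ) - 1) * p s ∧
      PsiKO f g (v r) ≤ f (a / g b + Lcoef n p) *
        ∫ t in r..R, t ^ (1 - (n : ℤ)) *
          ∫ s in (0:ℝ)..t, s ^ ((n : ℤ) - 1) * q s := by

  obtain ⟨m, rfl⟩ : ∃ m, n = m + 2 := ⟨n - 2, by omega⟩
  have hm : 1 ≤ m := by omega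
  obtain ⟨fc, gc, -, -, fm, gm, f0, g0, fp, gp⟩ := hF1
  obtain ⟨fs, gs⟩ := hF2
  obtain ⟨pc, qc, p0, q0, -, pi, qi, -⟩ := hPQ
  obtain ⟨uC, vC, hpos, hu, hv⟩ := hsol
  simp only [radK_eq] at hu hv
  intro r hr
  have eL : ∀ w, Lcoef (m+2) w = (1 / (m:ℝ)) * ∫ s in Ioi (0:ℝ), s * w s := by
    intro w; unfold Lcoef; push_cast; rw [add_sub_cancel_right]
  simp only [FFk_zpow, eL]
  exact ⟨KO_half m hm f g p q fc gc fm gm f0 g0 fp gp gs pc qc p0 q0 qi hint1 a b R ha hb u v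
      uC.continuousOn vC.continuousOn hpos hu hv hblowu r hr,
    KO_half m hm g f q p gc fc gm fm g0 f0 gp fp fs qc pc q0 p0 pi hint2 b a R hb ha v u
      vC.continuousOn uC.continuousOn (fun s hs => (hpos s hs).symm) hv hu hblowv r hr⟩
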